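/- arXiv:1701.08557 — 2 statements merged into one kernel-verified Lean document; each statement's English description precedes it below -/
import Mathlib

section
/- Let $A$ and $B$ be nonempty finite subsets of $\mathbb{R}^n$ with $K = |A| \leq |B| = L$, and suppose the affine span of the Minkowski sum $A+B$ is all of $\mathbb{R}^n$. If $L \leq n \leq K + L - 3$, then $|A+B| \geq K L - \frac{(K+L-n)(K+L-n-1)}{2}$. -/
open scoped Pointwise

section SumsetDimension

variable {V M : Type*} [AddCommGroup V] [DecidableEq V]

/-- The elements `a ∈ A` for which `a + b` is not already in `A + B`. -/
def newSummands (A B : Finset V) (b : V) : Finset V :=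
  A.filter fun a => a + b ∉ A + B

theorem mem_newSummands {A B : Finset V} {a b : V} :
    a ∈ newSummands A B b ↔ a ∈ A ∧ a + b ∉ A + B :=
  Finset.mem_filter

theorem card_add_insert (A B : Finset V) (b : V) :
    (A + insert b B).card = (A + B).card + (newSummands A B b).card := by
  have h : A + insert b B = (A + B) ∪ (newSummands A B b).image (· + b) := by
    ext x
    simp only [Finset.mem_union, Finset.mem_image, mem_newSummands]
    constructor
    · intro hx
      by_cases hx' : x ∈ A + B
      · exact Or.inl hx'
      · obtain ⟨a, ha, c, hc, rfl⟩ := Finset.mem_add.1 hx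
        rcases Finset.mem_insert.1 hc with rfl | hc
        · exact Or.inr ⟨a, ⟨ha, hx'⟩, rfl⟩
        · exact absurd (Finset.add_mem_add ha hc) hx'
    · rintro (hx | ⟨a, ⟨ha, -⟩, rfl⟩)
      · exact Finset.add_subset_add_left (Finset.subset_insert b B) hx
      · exact Finset.add_mem_add ha (Finset.mem_insert_self b B)
  rw [h, Finset.card_union_of_disjoint, Finset.card_image_of_injective _ (add_left_injective b)]
  rw [Finset.disjoint_right]
  intro x hx
  obtain ⟨a, ha, rfl⟩ := Finset.mem_image.1 hx
  exact (mem_newSummands.1 ha).2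

variable [Module ℝ V]

theorem finrank_vectorSpan_add_one_le_card {A : Finset V} (hA : A.Nonempty) :
    Module.finrank ℝ (vectorSpan ℝ (A : Set V)) + 1 ≤ A.card := by
  have h := finrank_vectorSpan_image_finset_le ℝ (id : V → V) A (n := A.card - 1)
    (by have := hA.card_pos; omega)
  rw [Finset.image_id] at h
  have := hA.card_pos
  omega

instance finiteDimensional_vectorSpan_coe_finset (A : Finset V) :
    FiniteDimensional ℝ (vectorSpan ℝ (A : Set V)) :=
  finiteDimensional_vectorSpan_of_finite ℝ A.finite_toSet

/-- Every element of `A` differs from a new summand by a vector in the span of the directions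
of `insert b B`, when `b` exceeds `B` in a translation-invariant linear order. -/
theorem exists_newSummand_sub_mem [AddCommGroup M] [LinearOrder M] [IsOrderedAddMonoid M]
    (g : V →+ M) {A B : Finset V} {b : V} (hb : ∀ c ∈ B, g c < g b) {a : V} (ha : a ∈ A) :
    ∃ u ∈ newSummands A B b, a - u ∈ vectorSpan ℝ ((insert b B : Finset V) : Set V) := by
  classical
  set S := vectorSpan ℝ ((insert b B : Finset V) : Set V)
  obtain ⟨u, hu, hmax⟩ := Finset.exists_max_image
    (A.filter fun u => ∃ w ∈ S, a - u = w) g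
    ⟨a, Finset.mem_filter.2 ⟨ha, 0, S.zero_mem, sub_self a⟩⟩
  obtain ⟨huA, w, hw, huw⟩ := Finset.mem_filter.1 hu
  refine ⟨u, mem_newSummands.2 ⟨huA, fun h => ?_⟩, huw ▸ hw⟩
  obtain ⟨a', ha', c, hc, hac⟩ := Finset.mem_add.1 h
  have hbc : b - c ∈ S := vsub_mem_vectorSpan ℝ
    (Finset.mem_coe.2 (Finset.mem_insert_self b B))
    (Finset.mem_coe.2 (Finset.mem_insert_of_mem hc))
  have hle := hmax a' (Finset.mem_filter.2 ⟨ha', w - (b - c), S.sub_mem hw hbc, by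
    rw [← huw, eq_sub_of_add_eq hac]; abel⟩)
  have hg : g a' + g c = g u + g b := by rw [← map_add, ← map_add, hac]
  exact absurd hg (add_lt_add_of_le_of_lt hle (hb c hc)).ne

theorem finrank_add_one_le_card_newSummands_add_card
    [AddCommGroup M] [LinearOrder M] [IsOrderedAddMonoid M]
    (g : V →+ M) {A B : Finset V} {b : V} (hA : A.Nonempty) (hb : ∀ c ∈ B, g c < g b) :
    Module.finrank ℝ ↥(vectorSpan ℝ (A : Set V) ⊔
      vectorSpan ℝ ((insert b B : Finset V) : Set V)) + 1 ≤
      (newSummands A B b).card + B.card := by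
  set S := vectorSpan ℝ ((insert b B : Finset V) : Set V)
  set T := vectorSpan ℝ (newSummands A B b : Set V)
  have hle : vectorSpan ℝ (A : Set V) ⊔ S ≤ T ⊔ S := by
    refine sup_le (Submodule.span_le.2 ?_) le_sup_right
    rintro _ ⟨a, ha, a', ha', rfl⟩
    obtain ⟨u, hu, hau⟩ := exists_newSummand_sub_mem g hb ha
    obtain ⟨u', hu', hau'⟩ := exists_newSummand_sub_mem g hb ha'
    have huu : u - u' ∈ T := vsub_mem_vectorSpan ℝ (Finset.mem_coe.2 hu) (Finset.mem_coe.2 hu')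
    have : a - a' = (u - u') + ((a - u) - (a' - u')) := by abel
    change a - a' ∈ T ⊔ S
    rw [this]
    exact Submodule.add_mem_sup huu (S.sub_mem hau hau')
  obtain ⟨a, ha⟩ := hA
  obtain ⟨u, hu, -⟩ := exists_newSummand_sub_mem g hb ha
  have hT : Module.finrank ℝ T + 1 ≤ _ := finrank_vectorSpan_add_one_le_card ⟨u, hu⟩
  have hS : Module.finrank ℝ S + 1 ≤ _ :=
    finrank_vectorSpan_add_one_le_card ⟨b, Finset.mem_insert_self b B⟩
  have hcard := Finset.card_insert_le b B
  have h1 := Submodule.finrank_mono hle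
  have h2 := Submodule.finrank_add_le_finrank_add_finrank T S
  omega

theorem vectorSpan_insert_le {B : Finset V} {b c : V} (hc : c ∈ B) :
    vectorSpan ℝ ((insert b B : Finset V) : Set V) ≤
      vectorSpan ℝ (B : Set V) ⊔ Submodule.span ℝ {b - c} := by
  rw [vectorSpan_eq_span_vsub_set_right ℝ
    (Finset.mem_coe.2 (Finset.mem_insert_of_mem hc)), Submodule.span_le]
  rintro _ ⟨x, hx, rfl⟩
  rcases Finset.mem_insert.1 (Finset.mem_coe.1 hx) with rfl | hx
  · exact Submodule.mem_sup_right (Submodule.mem_span_singleton_self _)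
  · exact Submodule.mem_sup_left
      (vsub_mem_vectorSpan ℝ (Finset.mem_coe.2 hx) (Finset.mem_coe.2 hc))

theorem finrank_sup_vectorSpan_insert_le (A : Finset V) {B : Finset V} (b : V)
    (hB : B.Nonempty) :
    Module.finrank ℝ ↥(vectorSpan ℝ (A : Set V) ⊔
      vectorSpan ℝ ((insert b B : Finset V) : Set V)) ≤
      Module.finrank ℝ ↥(vectorSpan ℝ (A : Set V) ⊔ vectorSpan ℝ (B : Set V)) + 1 := by
  obtain ⟨c, hc⟩ := hB
  have hle := sup_le_sup_left (vectorSpan_insert_le (b := b) hc) (vectorSpan ℝ (A : Set V))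
  rw [← sup_assoc] at hle
  have h1 := Submodule.finrank_mono hle
  have h2 := Submodule.finrank_add_le_finrank_add_finrank
    (vectorSpan ℝ (A : Set V) ⊔ vectorSpan ℝ (B : Set V)) (Submodule.span ℝ {b - c})
  have h3 := finrank_span_le_card (R := ℝ) ({b - c} : Set V)
  rw [Set.toFinset_singleton, Finset.card_singleton] at h3
  omega

/-- If inserting `b` into `B` raises the dimension of `A + B`, then all the sums `a + b`
are new. -/
theorem newSummands_eq_self {A B : Finset V} {b : V}
    (h : Module.finrank ℝ ↥(vectorSpan ℝ (A : Set V) ⊔ vectorSpan ℝ (B : Set V)) <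
      Module.finrank ℝ ↥(vectorSpan ℝ (A : Set V) ⊔
        vectorSpan ℝ ((insert b B : Finset V) : Set V))) :
    newSummands A B b = A := by
  refine Finset.filter_true_of_mem fun a ha hab => h.not_ge (Submodule.finrank_mono ?_)
  obtain ⟨a', ha', c, hc, hac⟩ := Finset.mem_add.1 hab
  have hbc : b - c = a' - a := by
    rw [sub_eq_sub_iff_add_eq_add, add_comm b a, hac]
  refine sup_le le_sup_left ((vectorSpan_insert_le hc).trans (sup_le le_sup_right ?_))
  rw [Submodule.span_singleton_le_iff_mem, hbc]
  exact Submodule.mem_sup_left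
    (vsub_mem_vectorSpan ℝ (Finset.mem_coe.2 ha') (Finset.mem_coe.2 ha))

/-- With `d = dim (A + B)` and `s = |A| + |B| - 1 - d`, one has
`|A + B| ≥ |A| |B| - s (s - 1) / 2`. -/
theorem two_mul_card_mul_card_le_two_mul_card_add
    [AddCommGroup M] [LinearOrder M] [IsOrderedAddMonoid M]
    (g : V →+ M) (hg : Function.Injective g) {A : Finset V} (hA : A.Nonempty)
    {B : Finset V} (hB : B.Nonempty) {s : ℤ}
    (hs : s = A.card + B.card - 1 - Module.finrank ℝ
      ↥(vectorSpan ℝ (A : Set V) ⊔ vectorSpan ℝ (B : Set V))) :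
    2 * ((A.card : ℤ) * B.card) ≤ 2 * ((A + B).card : ℤ) + s * (s - 1) := by
  induction B using Finset.induction_on_max_value g generalizing s with
  | empty => exact absurd hB Finset.not_nonempty_empty
  | insert b B hbB hmax ih =>
    rw [card_add_insert, Finset.card_insert_of_notMem hbB]
    rw [Finset.card_insert_of_notMem hbB] at hs
    rcases B.eq_empty_or_nonempty with rfl | hB'
    · have : newSummands A ∅ b = A := Finset.filter_true_of_mem fun a _ => by simp
      rw [this]
      have : 0 ≤ s * (s - 1) := by
        rcases le_or_gt s 0 with h | h <;> nlinarith
      simp only [Finset.card_empty, Finset.add_empty]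
      push_cast
      linarith
    have hlt : ∀ c ∈ B, g c < g b := fun c hc =>
      (hmax c hc).lt_of_ne fun h => hbB (hg h ▸ hc)
    have hnew := finrank_add_one_le_card_newSummands_add_card g hA hlt
    have hmono := Submodule.finrank_mono (sup_le_sup_left (vectorSpan_mono ℝ
      (Finset.coe_subset.2 (Finset.subset_insert b B))) (vectorSpan ℝ (A : Set V)))
    have hsucc := finrank_sup_vectorSpan_insert_le A b hB'
    have key := ih hB' rfl
    push_cast at hs ⊢
    rcases hmono.lt_or_eq with h | h
    · rw [newSummands_eq_self h]
      have hd := le_antisymm hsucc h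
      rw [hd] at hs
      push_cast at hs
      rw [show (A.card + B.card - 1 - Module.finrank ℝ
        ↥(vectorSpan ℝ (A : Set V) ⊔ vectorSpan ℝ (B : Set V)) : ℤ) = s by rw [hs]; ring] at key
      linarith
    · rw [← h] at hs hnew
      rw [show (A.card + B.card - 1 - Module.finrank ℝ
        ↥(vectorSpan ℝ (A : Set V) ⊔ vectorSpan ℝ (B : Set V)) : ℤ) = s - 1 by
          rw [hs]; ring] at key
      zify at hnew
      linarith

theorem vectorSpan_add_le (A B : Finset V) :
    vectorSpan ℝ ((A + B : Finset V) : Set V) ≤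
      vectorSpan ℝ (A : Set V) ⊔ vectorSpan ℝ (B : Set V) := by
  refine Submodule.span_le.2 ?_
  rintro _ ⟨x, hx, y, hy, rfl⟩
  obtain ⟨a, ha, b, hb, rfl⟩ := Finset.mem_add.1 (Finset.mem_coe.1 hx)
  obtain ⟨a', ha', b', hb', rfl⟩ := Finset.mem_add.1 (Finset.mem_coe.1 hy)
  change a + b - (a' + b') ∈ _
  rw [add_sub_add_comm]
  exact Submodule.add_mem_sup
    (vsub_mem_vectorSpan ℝ (Finset.mem_coe.2 ha) (Finset.mem_coe.2 ha'))
    (vsub_mem_vectorSpan ℝ (Finset.mem_coe.2 hb) (Finset.mem_coe.2 hb'))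

end SumsetDimension

/-- If `A, B ⊆ ℝⁿ` are finite, `K = |A| ≤ |B| = L`, the Minkowski sum `A + B` affinely
spans `ℝⁿ`, and `L ≤ n ≤ K + L - 3`, then `|A+B| ≥ KL - (K+L-n)(K+L-n-1)/2`. -/
theorem sumset_card_lower_bound_large_dim (n : ℕ)
    (A B : Finset (Fin n → ℝ)) (hA : A.Nonempty) (hB : B.Nonempty)
    (hAB : A.card ≤ B.card)
    (hspan : affineSpan ℝ ((A + B : Finset (Fin n → ℝ)) : Set (Fin n → ℝ)) = ⊤)
    (hn1 : B.card ≤ n) (hn2 : (n : ℤ) ≤ A.card + B.card - 3) :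
    (A.card : ℤ) * B.card
      - ((A.card : ℤ) + B.card - n) * ((A.card : ℤ) + B.card - n - 1) / 2
      ≤ ((A + B).card : ℤ) := by
  have htop : vectorSpan ℝ (A : Set (Fin n → ℝ)) ⊔ vectorSpan ℝ (B : Set (Fin n → ℝ)) = ⊤ := by
    refine top_le_iff.1 (le_trans (le_of_eq ?_) (vectorSpan_add_le A B))
    rw [← direction_affineSpan, hspan, AffineSubspace.direction_top]
  have key := two_mul_card_mul_card_le_two_mul_card_add
    (toLexAddEquiv (Fin n → ℝ)).toAddMonoidHom (toLexAddEquiv (Fin n → ℝ)).injective hA hB rfl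
  rw [htop, finrank_top, Module.finrank_fin_fun] at key
  set s : ℤ := A.card + B.card - 1 - n with hs
  have h1 : (A.card : ℤ) + B.card - n = s + 1 := by rw [hs]; ring
  have h2 : (s + 1) * (s + 1 - 1) = s * (s - 1) + 2 * s := by ring
  rw [h1, h2]
  generalize s * (s - 1) = p at *
  generalize (A.card : ℤ) * B.card = q at *
  omega
end

section
/- Let $K \geq 3$ and $1 \leq n \leq 2K - 2$, and let $A, B \subseteq \mathbb{R}^n$ be finite sets with $|A| = |B| = K$ such that the affine span of $A+B$ is all of $\mathbb{R}^n$. Then $(n+2) \cdot K(K+1) \leq 2(K+2) \cdot |A+B|$. -/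
open scoped Pointwise

section

variable {n : ℕ} {A B : Finset (Fin n → ℝ)}

/-- A farthest point `a + b` of `A + B` from the origin exposes both `a` and `b`. -/
theorem exists_common_exposed_point (hA : A.Nonempty) (hB : B.Nonempty) :
    ∃ a ∈ A, ∃ b ∈ B, ∃ φ : (Fin n → ℝ) →ₗ[ℝ] ℝ,
      (∀ a' ∈ A, a' ≠ a → φ a' < φ a) ∧ (∀ b' ∈ B, b' ≠ b → φ b' < φ b) := by
  obtain ⟨x, hx, hmax⟩ := (A + B).exists_max_image (fun x => x ⬝ᵥ x) (hA.add hB)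
  obtain ⟨a, ha, b, hb, rfl⟩ := Finset.mem_add.1 hx
  have key : ∀ y ∈ A + B, y ≠ a + b → (a + b) ⬝ᵥ y < (a + b) ⬝ᵥ (a + b) := by
    intro y hy hne
    have h1 := hmax y hy
    have h2 : 0 < (y - (a + b)) ⬝ᵥ (y - (a + b)) := by
      have h3 : 0 ≤ (y - (a + b)) ⬝ᵥ (y - (a + b)) :=
        Finset.sum_nonneg fun i _ => mul_self_nonneg _
      exact lt_of_le_of_ne h3 fun h => hne (sub_eq_zero.1 (dotProduct_self_eq_zero.1 h.symm))
    rw [sub_dotProduct, dotProduct_sub, dotProduct_sub, dotProduct_comm y (a + b)] at h2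
    linarith
  refine ⟨a, ha, b, hb, dotProductBilin ℝ ℝ (a + b), fun a' ha' hne => ?_, fun b' hb' hne => ?_⟩
  · have := key (a' + b) (Finset.add_mem_add ha' hb) (by simpa using hne)
    rw [dotProduct_add, dotProduct_add (a + b) a b] at this
    simpa using this
  · have := key (a + b') (Finset.add_mem_add ha hb') (by simpa using hne)
    rw [dotProduct_add, dotProduct_add (a + b) a b] at this
    simpa using this

theorem sub_mem_vectorSpan_add_left {a a' : Fin n → ℝ} (ha : a ∈ A) (ha' : a' ∈ A)
    (hB : B.Nonempty) :
    a - a' ∈ vectorSpan ℝ ((A + B : Finset (Fin n → ℝ)) : Set (Fin n → ℝ)) := by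
  obtain ⟨b, hb⟩ := hB
  have := vsub_mem_vectorSpan ℝ (Finset.mem_coe.2 (Finset.add_mem_add ha hb))
    (Finset.mem_coe.2 (Finset.add_mem_add ha' hb))
  simpa using this

theorem sub_mem_vectorSpan_add_right {b b' : Fin n → ℝ} (hb : b ∈ B) (hb' : b' ∈ B)
    (hA : A.Nonempty) :
    b - b' ∈ vectorSpan ℝ ((A + B : Finset (Fin n → ℝ)) : Set (Fin n → ℝ)) := by
  rw [add_comm A B]
  exact sub_mem_vectorSpan_add_left hb hb' hA

/-- The dimension of the affine span of `A + B`. -/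
noncomputable abbrev sumDim (A B : Finset (Fin n → ℝ)) : ℕ :=
  Module.finrank ℝ (vectorSpan ℝ ((A + B : Finset (Fin n → ℝ)) : Set (Fin n → ℝ)))

theorem vectorSpan_add_le_s12 {a b : Fin n → ℝ} (hA : a ∈ A) (hB : b ∈ B)
    (S : Submodule ℝ (Fin n → ℝ)) (hSA : ∀ a' ∈ A, a' - a ∈ S) (hSB : ∀ b' ∈ B, b' - b ∈ S) :
    vectorSpan ℝ ((A + B : Finset (Fin n → ℝ)) : Set (Fin n → ℝ)) ≤ S := by
  rw [vectorSpan_eq_span_vsub_set_right ℝ (Finset.mem_coe.2 (Finset.add_mem_add hA hB)),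
    Submodule.span_le]
  rintro _ ⟨x, hx, rfl⟩
  obtain ⟨a', ha', b', hb', rfl⟩ := Finset.mem_add.1 (Finset.mem_coe.1 hx)
  have := S.add_mem (hSA a' ha') (hSB b' hb')
  simpa [add_sub_add_comm] using this

theorem finrank_sup_span_singleton_le (S : Submodule ℝ (Fin n → ℝ)) (v : Fin n → ℝ) :
    Module.finrank ℝ ↥(S ⊔ Submodule.span ℝ {v}) ≤ Module.finrank ℝ S + 1 := by
  have h1 := Submodule.finrank_add_le_finrank_add_finrank S (Submodule.span ℝ {v})
  have h2 := finrank_span_le_card (R := ℝ) ({v} : Set (Fin n → ℝ))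
  simp only [Set.toFinset_singleton, Finset.card_singleton] at h2
  omega

/-- Deleting a common exposed point from both summands destroys at least `sumDim A B + 1` sums. -/
theorem sumDim_lt_card_sdiff {a b : Fin n → ℝ} (ha : a ∈ A) (hb : b ∈ B)
    (φ : (Fin n → ℝ) →ₗ[ℝ] ℝ) (hφA : ∀ a' ∈ A, a' ≠ a → φ a' < φ a)
    (hφB : ∀ b' ∈ B, b' ≠ b → φ b' < φ b) (hab : a + b ∉ A.erase a + B.erase b) :
    sumDim A B + 1 ≤ ((A + B) \ (A.erase a + B.erase b)).card := by
  classical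
  set N := (A + B) \ (A.erase a + B.erase b) with hN
  have habN : a + b ∈ N := Finset.mem_sdiff.2 ⟨Finset.add_mem_add ha hb, hab⟩
  have hsub : ∀ x ∈ A + B, x ∈ affineSpan ℝ (N : Set (Fin n → ℝ)) := by
    by_contra! hcon
    obtain ⟨x₀, hx₀, hx₀'⟩ := hcon
    obtain ⟨x, hx, hmax⟩ := ((A + B).filter
      fun x => x ∉ affineSpan ℝ (N : Set (Fin n → ℝ))).exists_max_image φ
      ⟨x₀, Finset.mem_filter.2 ⟨hx₀, hx₀'⟩⟩
    obtain ⟨hxAB, hxN⟩ := Finset.mem_filter.1 hx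
    have hx' : x ∈ A.erase a + B.erase b := by
      by_contra h
      exact hxN (subset_affineSpan ℝ _ (Finset.mem_coe.2 (Finset.mem_sdiff.2 ⟨hxAB, h⟩)))
    obtain ⟨a', ha', b', hb', rfl⟩ := Finset.mem_add.1 hx'
    obtain ⟨hane, ha'⟩ := Finset.mem_erase.1 ha'
    obtain ⟨hbne, hb'⟩ := Finset.mem_erase.1 hb'
    have hlarger : ∀ y ∈ A + B, φ (a' + b') < φ y → y ∈ affineSpan ℝ (N : Set (Fin n → ℝ)) := by
      intro y hy hlt
      by_contra h
      exact absurd (hmax y (Finset.mem_filter.2 ⟨hy, h⟩)) (not_le.2 hlt)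
    have h1 := hlarger (a' + b) (Finset.add_mem_add ha' hb) (by simpa using hφB b' hb' hbne)
    have h2 := hlarger (a + b') (Finset.add_mem_add ha hb') (by simpa using hφA a' ha' hane)
    have h3 := AffineSubspace.vadd_mem_of_mem_direction
      (AffineSubspace.vsub_mem_direction h1 (subset_affineSpan ℝ _ (Finset.mem_coe.2 habN))) h2
    refine hxN ?_
    convert h3 using 1
    simp only [vsub_eq_sub, vadd_eq_add]
    abel
  have hle : vectorSpan ℝ ((A + B : Finset (Fin n → ℝ)) : Set (Fin n → ℝ)) ≤
      vectorSpan ℝ (N : Set (Fin n → ℝ)) := by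
    rw [← direction_affineSpan, ← direction_affineSpan]
    exact AffineSubspace.direction_le (affineSpan_le.2 hsub)
  have hcard : N.card = (N.card - 1) + 1 :=
    (Nat.sub_add_cancel (Finset.card_pos.2 ⟨_, habN⟩)).symm
  have h1 := finrank_vectorSpan_image_finset_le ℝ (id : (Fin n → ℝ) → _) N hcard
  rw [Finset.image_id] at h1
  have h2 : sumDim A B ≤ _ := Submodule.finrank_mono hle
  omega

/-- One deletion step: erasing suitable `a ∈ A` and `b ∈ B` lowers the dimension of the sumset by
at most two, and the number of sums lost is bounded below according to the drop. -/
theorem exists_erase_step {k : ℕ} (hk : 2 ≤ k) (hA : A.card = k) (hB : B.card = k) :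
    ∃ a ∈ A, ∃ b ∈ B, ∃ N : ℕ,
      (A.erase a + B.erase b).card + N = (A + B).card ∧
      sumDim (A.erase a) (B.erase b) ≤ sumDim A B ∧
      sumDim A B ≤ sumDim (A.erase a) (B.erase b) + 2 ∧
      sumDim A B + 1 ≤ N ∧
      (sumDim (A.erase a) (B.erase b) < sumDim A B → k ≤ N) ∧
      (sumDim (A.erase a) (B.erase b) + 1 < sumDim A B → 2 * k ≤ N + 1) := by
  obtain ⟨a, ha, b, hb, φ, hφA, hφB⟩ := exists_common_exposed_point (A := A) (B := B)
    (Finset.card_pos.1 (by omega)) (Finset.card_pos.1 (by omega))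
  have hsubset : A.erase a + B.erase b ⊆ A + B :=
    Finset.add_subset_add (Finset.erase_subset _ _) (Finset.erase_subset _ _)
  have hab : a + b ∉ A.erase a + B.erase b := by
    intro h
    obtain ⟨a', ha', b', hb', h⟩ := Finset.mem_add.1 h
    have h1 := hφA a' (Finset.mem_of_mem_erase ha') (Finset.ne_of_mem_erase ha')
    have h2 := hφB b' (Finset.mem_of_mem_erase hb') (Finset.ne_of_mem_erase hb')
    have h3 := congrArg φ h
    rw [map_add, map_add] at h3
    linarith
  obtain ⟨a₁, ha₁⟩ : (A.erase a).Nonempty :=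
    Finset.card_pos.1 (by rw [Finset.card_erase_of_mem ha]; omega)
  obtain ⟨b₁, hb₁⟩ : (B.erase b).Nonempty :=
    Finset.card_pos.1 (by rw [Finset.card_erase_of_mem hb]; omega)
  set W := vectorSpan ℝ ((A.erase a + B.erase b : Finset (Fin n → ℝ)) : Set (Fin n → ℝ)) with hW
  have hWA : ∀ x ∈ A.erase a, ∀ y ∈ A.erase a, x - y ∈ W := fun x hx y hy =>
    sub_mem_vectorSpan_add_left hx hy ⟨b₁, hb₁⟩
  have hWB : ∀ x ∈ B.erase b, ∀ y ∈ B.erase b, x - y ∈ W := fun x hx y hy =>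
    sub_mem_vectorSpan_add_right hx hy ⟨a₁, ha₁⟩
  have hmono : ∀ S : Submodule ℝ (Fin n → ℝ), W ≤ S → a₁ - a ∈ S → b₁ - b ∈ S →
      sumDim A B ≤ Module.finrank ℝ S := by
    intro S hWS hα hβ
    refine Submodule.finrank_mono (vectorSpan_add_le_s12 ha hb S (fun a' ha' => ?_) fun b' hb' => ?_)
    · by_cases h : a' = a
      · simp [h]
      · have := S.add_mem (hWS (hWA a' (Finset.mem_erase.2 ⟨h, ha'⟩) a₁ ha₁)) hα
        simpa using this
    · by_cases h : b' = b
      · simp [h]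
      · have := S.add_mem (hWS (hWB b' (Finset.mem_erase.2 ⟨h, hb'⟩) b₁ hb₁)) hβ
        simpa using this
  have hle₁ : ∀ v : Fin n → ℝ, a₁ - a ∈ W ⊔ Submodule.span ℝ {v} →
      b₁ - b ∈ W ⊔ Submodule.span ℝ {v} → sumDim A B ≤ Module.finrank ℝ W + 1 := by
    intro v h1 h2
    exact (hmono _ le_sup_left h1 h2).trans (finrank_sup_span_singleton_le W v)
  have hself : ∀ v : Fin n → ℝ, v ∈ W ⊔ Submodule.span ℝ {v} := fun v =>
    Submodule.mem_sup_right (Submodule.mem_span_singleton_self v)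
  have hNA : b₁ - b ∉ W → A.image (· + b) ⊆ (A + B) \ (A.erase a + B.erase b) := by
    intro hβ x hx
    obtain ⟨a', ha', rfl⟩ := Finset.mem_image.1 hx
    refine Finset.mem_sdiff.2 ⟨Finset.add_mem_add ha' hb, fun h => ?_⟩
    by_cases haa : a' = a
    · subst haa
      exact hab h
    · obtain ⟨a'', ha'', b'', hb'', h⟩ := Finset.mem_add.1 h
      have h1 := W.add_mem (hWA a' (Finset.mem_erase.2 ⟨haa, ha'⟩) a'' ha'') (hWB b₁ hb₁ b'' hb'')
      refine hβ ?_
      convert h1 using 1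
      rw [sub_add_sub_comm, h]
      abel
  have hNB : a₁ - a ∉ W → B.image (a + ·) ⊆ (A + B) \ (A.erase a + B.erase b) := by
    intro hα x hx
    obtain ⟨b', hb', rfl⟩ := Finset.mem_image.1 hx
    refine Finset.mem_sdiff.2 ⟨Finset.add_mem_add ha hb', fun h => ?_⟩
    by_cases hbb : b' = b
    · subst hbb
      exact hab h
    · obtain ⟨a'', ha'', b'', hb'', h⟩ := Finset.mem_add.1 h
      have h1 := W.add_mem (hWA a₁ ha₁ a'' ha'') (hWB b' (Finset.mem_erase.2 ⟨hbb, hb'⟩) b'' hb'')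
      refine hα ?_
      convert h1 using 1
      rw [sub_add_sub_comm, h]
      abel
  have hcardA : (A.image (· + b)).card = k := by
    rw [Finset.card_image_of_injective _ (add_left_injective b), hA]
  have hcardB : (B.image (a + ·)).card = k := by
    rw [Finset.card_image_of_injective _ (add_right_injective a), hB]
  refine ⟨a, ha, b, hb, ((A + B) \ (A.erase a + B.erase b)).card, ?_, ?_, ?_,
    sumDim_lt_card_sdiff ha hb φ hφA hφB hab, fun hlt => ?_, fun hlt => ?_⟩
  · rw [add_comm]
    exact Finset.card_sdiff_add_card_eq_card hsubset
  · exact Submodule.finrank_mono (vectorSpan_mono ℝ (Finset.coe_subset.2 hsubset))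
  · have h1 := hmono (W ⊔ Submodule.span ℝ {a₁ - a} ⊔ Submodule.span ℝ {b₁ - b})
      (le_sup_left.trans le_sup_left) (Submodule.mem_sup_left (hself _))
      (Submodule.mem_sup_right (Submodule.mem_span_singleton_self _))
    have h2 := finrank_sup_span_singleton_le (W ⊔ Submodule.span ℝ {a₁ - a}) (b₁ - b)
    have h3 := finrank_sup_span_singleton_le W (a₁ - a)
    change sumDim A B ≤ Module.finrank ℝ W + 2
    omega
  · by_cases hβ : b₁ - b ∈ W
    · have hα : a₁ - a ∉ W := fun hα => absurd (hmono W le_rfl hα hβ) (not_le.2 hlt)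
      exact hcardB ▸ Finset.card_le_card (hNB hα)
    · exact hcardA ▸ Finset.card_le_card (hNA hβ)
  · have hα : a₁ - a ∉ W := fun hα =>
      absurd (hle₁ (b₁ - b) (Submodule.mem_sup_left hα) (hself _)) (not_le.2 hlt)
    have hβ : b₁ - b ∉ W := fun hβ =>
      absurd (hle₁ (a₁ - a) (hself _) (Submodule.mem_sup_left hβ)) (not_le.2 hlt)
    have hinter : A.image (· + b) ∩ B.image (a + ·) ⊆ {a + b} := by
      intro x hx
      obtain ⟨hxA, hxB⟩ := Finset.mem_inter.1 hx
      obtain ⟨a', ha', rfl⟩ := Finset.mem_image.1 hxA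
      obtain ⟨b', hb', h⟩ := Finset.mem_image.1 hxB
      by_contra hne
      have haa : a' ≠ a := fun haa => hne (by simp [haa])
      have hbb : b' ≠ b := fun hbb => hne (by simp [← h, hbb])
      refine absurd (hle₁ (b₁ - b) ?_ (hself _)) (not_le.2 hlt)
      have h1 := W.add_mem (hWA a₁ ha₁ a' (Finset.mem_erase.2 ⟨haa, ha'⟩))
        (hWB b' (Finset.mem_erase.2 ⟨hbb, hb'⟩) b₁ hb₁)
      have h2 := Submodule.add_mem _ (Submodule.mem_sup_left (T := Submodule.span ℝ {b₁ - b}) h1)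
        (hself (b₁ - b))
      convert h2 using 1
      have h3 : a' = a + b' - b := by rw [h]; abel
      rw [h3]
      abel
    have h1 := Finset.card_union_add_card_inter (A.image (· + b)) (B.image (a + ·))
    have h2 := Finset.card_le_card hinter
    have h3 := Finset.card_le_card (Finset.union_subset (hNA hβ) (hNB hα))
    rw [Finset.card_singleton] at h2
    omega

/-- Ruzsa's lower bound for `|A + B|` when `|A| = |B| = k`, together with its strengthening in the
range where the dimension `d` of `A + B` is at least `k - 1`. -/
theorem card_add_lower_bounds (k : ℕ) (hk : 1 ≤ k) :
    ∀ A B : Finset (Fin n → ℝ), A.card = k → B.card = k →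
      sumDim A B + 2 ≤ 2 * k ∧
      2 * (k : ℤ) * (sumDim A B + 1) ≤ 2 * (A + B).card + sumDim A B * (sumDim A B + 1) ∧
      (k ≤ sumDim A B + 1 →
        2 * (k : ℤ) ^ 2 ≤ 2 * (A + B).card +
          (2 * k - 2 - sumDim A B) * (2 * k - 1 - sumDim A B)) := by
  induction k, hk using Nat.le_induction with
  | base =>
    intro A B hA hB
    obtain ⟨a, rfl⟩ := Finset.card_eq_one.1 hA
    obtain ⟨b, rfl⟩ := Finset.card_eq_one.1 hB
    have h : sumDim {a} {b} = 0 := by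
      rw [sumDim, Finset.singleton_add_singleton, Finset.coe_singleton, vectorSpan_singleton,
        finrank_bot]
    simp [h]
  | succ k hk ih =>
    intro A B hA hB
    obtain ⟨a, ha, b, hb, N, hN, hmono, hdrop, h1, h2, h3⟩ :=
      exists_erase_step (by omega) hA hB
    obtain ⟨ih1, ih2, ih3⟩ := ih (A.erase a) (B.erase b)
      (by rw [Finset.card_erase_of_mem ha, hA]; rfl)
      (by rw [Finset.card_erase_of_mem hb, hB]; rfl)
    rw [← hN]
    generalize sumDim A B = d at *
    generalize sumDim (A.erase a) (B.erase b) = d' at *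
    generalize (A.erase a + B.erase b).card = s at *
    have hcases : d = d' ∨ d = d' + 1 ∨ d = d' + 2 := by omega
    clear hN hA hB ih
    refine ⟨by omega, ?_, fun hd => ?_⟩
    · rcases hcases with rfl | rfl | rfl
      · zify at *
        nlinarith
      · have h2 := h2 (by omega)
        zify at *
        nlinarith
      · have h3 := h3 (by omega)
        zify at *
        nlinarith
    · by_cases hdk : d = k
      · subst hdk
        rcases hcases with h | h | h
        · have ih3 := ih3 (by omega)
          subst h
          zify at *
          nlinarith
        · have h2 := h2 (by omega)
          subst h
          zify at *
          nlinarith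
        · have h3 := h3 (by omega)
          subst h
          zify at *
          nlinarith
      · have ih3 := ih3 (by omega)
        rcases hcases with rfl | rfl | rfl
        · zify at *
          nlinarith
        · zify at *
          nlinarith
        · have h3 := h3 (by omega)
          zify at *
          nlinarith

end

/-- `ρ(K,K) = 2(K+2)/(K(K+1))` for `K ≥ 3`: if `A, B ⊆ ℝⁿ` are finite with
`|A| = |B| = K ≥ 3`, `1 ≤ n ≤ 2K - 2`, and `A + B` affinely spans `ℝⁿ`, then
`(n+2)·K(K+1) ≤ 2(K+2)·|A+B|`. -/
theorem rho_diag_bound (K n : ℕ) (hK : 3 ≤ K) (hn1 : 1 ≤ n) (hn2 : n ≤ 2 * K - 2)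
    (A B : Finset (Fin n → ℝ)) (hA : A.card = K) (hB : B.card = K)
    (hspan : affineSpan ℝ ((A + B : Finset (Fin n → ℝ)) : Set (Fin n → ℝ)) = ⊤) :
    (n + 2) * (K * (K + 1)) ≤ 2 * (K + 2) * (A + B).card := by
  have hdim : sumDim A B = n := by
    rw [sumDim, ← direction_affineSpan, hspan, AffineSubspace.direction_top, finrank_top,
      Module.finrank_fin_fun]
  obtain ⟨-, h1, h2⟩ := card_add_lower_bounds K (by omega) A B hA hB
  rw [hdim] at h1 h2
  zify
  rcases le_total n K with hnK | hnK
  · have h3 : (0 : ℤ) ≤ (K - n) * ((K + 2) * n + 2) :=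
      mul_nonneg (by omega) (by positivity)
    have h4 := mul_le_mul_of_nonneg_left h1 (by positivity : (0 : ℤ) ≤ K + 2)
    linarith
  · have h2 := h2 (by omega)
    obtain ⟨m, hm⟩ : ∃ m : ℕ, n + m + 2 = 2 * K := ⟨2 * K - 2 - n, by omega⟩
    have hn : (n : ℤ) = 2 * K - 2 - m := by omega
    have h4 := mul_le_mul_of_nonneg_left h2 (by positivity : (0 : ℤ) ≤ K + 2)
    have h5 : (0 : ℤ) ≤ m * ((K + 2) * (K - 2 - m)) :=
      mul_nonneg (by positivity) (mul_nonneg (by positivity) (by omega))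
    have h6 : (0 : ℤ) ≤ 2 * K ^ 2 + 2 * m := by positivity
    rw [hn] at h4 ⊢
    linarith
end
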